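/- Let X and Y be real Banach spaces and S : X → Y a bounded linear operator. Then for every real α > 0 and every n ≥ 1, the n-th approximation number satisfies a_n(S) ≤ 2 · e^α · n^{−α+3/2} · sup_{1 ≤ k ≤ n} k^α h_k(S), where h_k are the Hilbert numbers. -/

import Mathlib

/-- The real Hilbert sequence space ℓ₂ = lp(ℕ, 2). -/
abbrev Ell2 : Type := lp (fun _ : ℕ => ℝ) 2

/-- Approximation numbers. -/
noncomputable def approxNumber {X Y : Type*} [NormedAddCommGroup X] [NormedSpace ℝ X]
    [NormedAddCommGroup Y] [NormedSpace ℝ Y] (n : ℕ) (S : X →L[ℝ] Y) : ℝ :=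
  sInf {r : ℝ | ∃ L : X →L[ℝ] Y, LinearMap.rank (L : X →ₗ[ℝ] Y) < n ∧ r = ‖S - L‖}

/-- Gelfand numbers. -/
noncomputable def gelfandNumber {X Y : Type*} [NormedAddCommGroup X] [NormedSpace ℝ X]
    [NormedAddCommGroup Y] [NormedSpace ℝ Y] (n : ℕ) (S : X →L[ℝ] Y) : ℝ :=
  sInf {r : ℝ | ∃ M : Submodule ℝ X, IsClosed (M : Set X) ∧ Module.rank ℝ (X ⧸ M) < n ∧
    r = ‖S.comp M.subtypeL‖}

/-- The canonical quotient map onto `Y ⧸ N`, as a continuous linear map (with respect to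
the quotient (semi)norm). -/
noncomputable def quotientCLM {Y : Type*} [NormedAddCommGroup Y] [NormedSpace ℝ Y]
    (N : Submodule ℝ Y) : Y →L[ℝ] Y ⧸ N :=
  LinearMap.mkContinuous N.mkQ 1 fun y => by
    simpa using Submodule.Quotient.norm_mk_le N y

/-- Kolmogorov numbers. -/
noncomputable def kolmogorovNumber {X Y : Type*} [NormedAddCommGroup X] [NormedSpace ℝ X]
    [NormedAddCommGroup Y] [NormedSpace ℝ Y] (n : ℕ) (S : X →L[ℝ] Y) : ℝ :=
  sInf {r : ℝ | ∃ N : Submodule ℝ Y, Module.rank ℝ N < n ∧ r = ‖(quotientCLM N).comp S‖}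

/-- Hilbert numbers. -/
noncomputable def hilbertNumber {X Y : Type*} [NormedAddCommGroup X] [NormedSpace ℝ X]
    [NormedAddCommGroup Y] [NormedSpace ℝ Y] (n : ℕ) (S : X →L[ℝ] Y) : ℝ :=
  sSup {r : ℝ | ∃ (A : Ell2 →L[ℝ] X) (B : Y →L[ℝ] Ell2), A ≠ 0 ∧ B ≠ 0 ∧
    r = approxNumber n (B.comp (S.comp A)) / (‖B‖ * ‖A‖)}

section ApproxBasic

variable {X Y : Type*} [NormedAddCommGroup X] [NormedSpace ℝ X]
    [NormedAddCommGroup Y] [NormedSpace ℝ Y]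

lemma approx_bddBelow (n : ℕ) (S : X →L[ℝ] Y) : BddBelow
    {r : ℝ | ∃ L : X →L[ℝ] Y, LinearMap.rank (L : X →ₗ[ℝ] Y) < n ∧ r = ‖S - L‖} :=
  ⟨0, by rintro r ⟨L, -, rfl⟩; exact norm_nonneg _⟩

lemma approx_nonneg (n : ℕ) (S : X →L[ℝ] Y) : 0 ≤ approxNumber n S :=
  Real.sInf_nonneg (by rintro r ⟨L, -, rfl⟩; exact norm_nonneg _)

lemma approx_le (n : ℕ) (S L : X →L[ℝ] Y) (h : LinearMap.rank (L : X →ₗ[ℝ] Y) < n) :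
    approxNumber n S ≤ ‖S - L‖ :=
  csInf_le (approx_bddBelow n S) ⟨L, h, rfl⟩

lemma approx_set_nonempty (n : ℕ) (hn : 1 ≤ n) (S : X →L[ℝ] Y) :
    {r : ℝ | ∃ L : X →L[ℝ] Y, LinearMap.rank (L : X →ₗ[ℝ] Y) < n ∧ r = ‖S - L‖}.Nonempty := by
  refine ⟨_, 0, ?_, rfl⟩
  have : LinearMap.rank ((0 : X →L[ℝ] Y) : X →ₗ[ℝ] Y) = 0 := by
    rw [ContinuousLinearMap.toLinearMap_zero]; exact LinearMap.rank_zero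
  rw [this]
  exact_mod_cast hn

lemma approx_le_norm (n : ℕ) (hn : 1 ≤ n) (S : X →L[ℝ] Y) : approxNumber n S ≤ ‖S‖ := by
  have : LinearMap.rank ((0 : X →L[ℝ] Y) : X →ₗ[ℝ] Y) = 0 := by
    rw [ContinuousLinearMap.toLinearMap_zero]; exact LinearMap.rank_zero
  have h := approx_le n S 0 (by rw [this]; exact_mod_cast hn)
  simpa using h

lemma approx_exists (n : ℕ) (hn : 1 ≤ n) (S : X →L[ℝ] Y) {c : ℝ} (hc : approxNumber n S < c) :
    ∃ L : X →L[ℝ] Y, LinearMap.rank (L : X →ₗ[ℝ] Y) < n ∧ ‖S - L‖ < c := by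
  obtain ⟨r, ⟨L, h, rfl⟩, h2⟩ := exists_lt_of_csInf_lt (approx_set_nonempty n hn S) hc
  exact ⟨L, h, h2⟩

lemma approx_anti {m n : ℕ} (hm : 1 ≤ m) (hmn : m ≤ n) (S : X →L[ℝ] Y) :
    approxNumber n S ≤ approxNumber m S := by
  refine le_csInf (approx_set_nonempty m hm S) ?_
  rintro r ⟨L, h, rfl⟩
  exact approx_le n S L (h.trans_le (by exact_mod_cast hmn))

lemma hilbert_nonneg (n : ℕ) (S : X →L[ℝ] Y) : 0 ≤ hilbertNumber n S := by
  refine Real.sSup_nonneg ?_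
  rintro r ⟨A, B, -, -, rfl⟩
  exact div_nonneg (approx_nonneg _ _) (by positivity)

lemma approx_le_hilbert (n : ℕ) (hn : 1 ≤ n) (S : X →L[ℝ] Y) (A : Ell2 →L[ℝ] X)
    (B : Y →L[ℝ] Ell2) :
    approxNumber n (B.comp (S.comp A)) ≤ hilbertNumber n S * (‖B‖ * ‖A‖) := by
  by_cases hA : A = 0
  · subst hA
    simpa using approx_le_norm n hn (B.comp (S.comp (0 : Ell2 →L[ℝ] X)))
  by_cases hB : B = 0
  · subst hB
    simpa using approx_le_norm n hn ((0 : Y →L[ℝ] Ell2).comp (S.comp A))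
  have hA' := norm_pos_iff.mpr hA
  have hB' := norm_pos_iff.mpr hB
  rw [← div_le_iff₀ (by positivity)]
  refine le_csSup ⟨‖S‖, ?_⟩ ⟨A, B, hA, hB, rfl⟩
  rintro r ⟨A, B, hA, hB, rfl⟩
  have hA' := norm_pos_iff.mpr hA
  have hB' := norm_pos_iff.mpr hB
  rw [div_le_iff₀ (by positivity)]
  calc _ ≤ ‖B.comp (S.comp A)‖ := approx_le_norm n hn _
    _ ≤ ‖B‖ * (‖S‖ * ‖A‖) := (ContinuousLinearMap.opNorm_comp_le _ _).trans
        (by gcongr; exact ContinuousLinearMap.opNorm_comp_le _ _)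
    _ = _ := by ring

end ApproxBasic

section Hadamard

lemma exists_orthonormal_ker {E : Type} [NormedAddCommGroup E] [InnerProductSpace ℝ E]
    [FiniteDimensional ℝ E] (L : ℕ → E →ₗ[ℝ] E) (hL : ∀ k, Module.finrank ℝ (L k).range ≤ k)
    (m : ℕ) : ∀ W : Submodule ℝ E, Module.finrank ℝ W = m →
      ∃ v : Fin m → E, Orthonormal ℝ v ∧ (∀ k, v k ∈ W) ∧ ∀ k : Fin m, L k (v k) = 0 := by
  induction m with
  | zero => 
    intro W _
    exact ⟨Fin.elim0, ⟨fun i => i.elim0, fun i => i.elim0⟩, fun i => i.elim0, fun i => i.elim0⟩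
  | succ m ih =>
    intro W hW
    have h1 : ∃ u ∈ W, u ≠ 0 ∧ L m u = 0 := by
      have hr := LinearMap.finrank_range_add_finrank_ker ((L m).domRestrict W)
      have hle : Module.finrank ℝ ((L m).domRestrict W).range ≤ m :=
        (Submodule.finrank_mono (by
          rintro _ ⟨x, rfl⟩; exact ⟨x, rfl⟩)).trans (hL m)
      have hpos : 0 < Module.finrank ℝ ((L m).domRestrict W).ker := by omega
      have := Module.finrank_pos_iff_exists_ne_zero.mp hpos
      obtain ⟨⟨⟨u, hu⟩, hk⟩, hne⟩ := this
      refine ⟨u, hu, ?_, by simpa using hk⟩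
      rintro rfl
      exact hne rfl
    obtain ⟨u, huW, hu0, huL⟩ := h1
    have hn : ‖u‖ ≠ 0 := norm_ne_zero_iff.mpr hu0
    set w := ‖u‖⁻¹ • u with hw
    have hw1 : ‖w‖ = 1 := by rw [hw, norm_smul]; simp [hn]
    have hw0 : w ≠ 0 := by rintro h; simp [h] at hw1
    have hwW : w ∈ W := W.smul_mem _ huW
    have hwL : L m w = 0 := by simp [hw, huL]
    have hd := Submodule.finrank_add_inf_finrank_orthogonal' (K₁ := Submodule.span ℝ {w})
      (K₂ := W) (n := m) (by simpa using hwW) (by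
        rw [finrank_span_singleton hw0, hW, add_comm])
    obtain ⟨v, hv, hvW, hvL⟩ := ih _ hd
    have horth : ∀ k, inner ℝ w (v k) = 0 := fun k =>
      Submodule.mem_orthogonal_singleton_iff_inner_right.mp (hvW k).1
    refine ⟨Fin.snoc v w, ⟨?_, ?_⟩, ?_, ?_⟩
    · intro i
      refine Fin.lastCases ?_ (fun i => ?_) i
      · simpa using hw1
      · simpa using hv.1 i
    · intro i j
      refine Fin.lastCases ?_ (fun i => ?_) i <;> refine Fin.lastCases ?_ (fun j => ?_) j
      · simp
      · intro _; simpa using horth j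
      · intro _; simpa [real_inner_comm] using horth i
      · intro h; simpa using hv.2 (fun h' => h (by rw [h']))
    · intro i
      refine Fin.lastCases ?_ (fun i => ?_) i
      · simpa using hwW
      · simpa using (hvW i).2
    · intro i
      refine Fin.lastCases ?_ (fun i => ?_) i
      · simpa using hwL
      · simpa using hvL i

lemma abs_det_le_prod {n : ℕ} (T : EuclideanSpace ℝ (Fin n) →L[ℝ] EuclideanSpace ℝ (Fin n)) :
    |LinearMap.det (T : EuclideanSpace ℝ (Fin n) →ₗ[ℝ] EuclideanSpace ℝ (Fin n))| ≤
      ∏ k : Fin n, approxNumber (k + 1) T := by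
  have key : ∀ ε : ℝ, 0 < ε →
      |LinearMap.det (T : EuclideanSpace ℝ (Fin n) →ₗ[ℝ] EuclideanSpace ℝ (Fin n))| ≤
      ∏ k : Fin n, (approxNumber (k + 1) T + ε) := by
    intro ε hε
    choose L hL1 hL2 using fun k : ℕ => approx_exists (k + 1) (by omega) T
      (lt_add_of_pos_right (approxNumber (k + 1) T) hε)
    obtain ⟨v, hv, -, hvL⟩ := exists_orthonormal_ker (fun k => (L k).toLinearMap) (by
      intro k
      have h := hL1 k
      rw [LinearMap.rank, ← Module.finrank_eq_rank] at h
      have h' : Module.finrank ℝ (L k).toLinearMap.range < k + 1 := by exact_mod_cast h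
      omega) n ⊤ (by simp)
    have hsp : ⊤ ≤ Submodule.span ℝ (Set.range v) := by
      rw [hv.linearIndependent.span_eq_top_of_card_eq_finrank' (by simp)]
    let b := OrthonormalBasis.mk hv hsp
    have hb : ⇑b = v := OrthonormalBasis.coe_mk hv hsp
    have : Fact (Module.finrank ℝ (EuclideanSpace ℝ (Fin n)) = n) := ⟨by simp⟩
    have h1 := b.toBasis.orientation.abs_volumeForm_apply_le (T ∘ v)
    rw [b.toBasis.orientation.volumeForm_robust b rfl] at h1
    have h2 := b.toBasis.det_comp T.toLinearMap b.toBasis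
    rw [b.toBasis.det_self, mul_one] at h2
    have h3 : (T.toLinearMap ∘ b.toBasis) = T ∘ v := by
      funext i; simp [hb]
    rw [h3] at h2
    rw [h2] at h1
    refine h1.trans (Finset.prod_le_prod (fun _ _ => norm_nonneg _) fun k _ => ?_)
    have h4 : T (v k) = (T - L k) (v k) := by
      have := hvL k
      simp only [ContinuousLinearMap.coe_coe] at this
      simp [this]
    calc ‖T (v k)‖ = ‖(T - L k) (v k)‖ := by rw [h4]
      _ ≤ ‖T - L k‖ * ‖v k‖ := ContinuousLinearMap.le_opNorm _ _
      _ = ‖T - L k‖ := by rw [hv.1, mul_one]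
      _ ≤ _ := (hL2 k).le
  have hc : Filter.Tendsto (fun ε : ℝ => ∏ k : Fin n, (approxNumber (k + 1) T + ε))
      (nhdsWithin 0 (Set.Ioi 0)) (nhds (∏ k : Fin n, (approxNumber (k + 1) T + 0))) := by
    have : Continuous (fun ε : ℝ => ∏ k : Fin n, (approxNumber (k + 1) T + ε)) := by fun_prop
    exact this.continuousAt.tendsto.mono_left nhdsWithin_le_nhds
  simp only [add_zero] at hc
  exact ge_of_tendsto hc (by filter_upwards [self_mem_nhdsWithin] with ε hε using key ε hε)

end Hadamard
section Det

variable {X Y : Type*} [NormedAddCommGroup X] [NormedSpace ℝ X]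
    [NormedAddCommGroup Y] [NormedSpace ℝ Y]

lemma exists_embed (n : ℕ) : ∃ (J : EuclideanSpace ℝ (Fin n) →L[ℝ] Ell2)
    (P : Ell2 →L[ℝ] EuclideanSpace ℝ (Fin n)), ‖J‖ ≤ 1 ∧ ‖P‖ ≤ 1 ∧
      P.comp J = ContinuousLinearMap.id ℝ _ := by
  let hb : HilbertBasis ℕ ℝ Ell2 := HilbertBasis.ofRepr (LinearIsometryEquiv.refl ℝ _)
  have ho : Orthonormal ℝ (fun k : Fin n => hb k) := hb.orthonormal.comp _ Fin.val_injective
  let b := EuclideanSpace.basisFun (Fin n) ℝ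
  let f := b.toBasis.constr ℝ (fun k : Fin n => hb k)
  let J : EuclideanSpace ℝ (Fin n) →ₗᵢ[ℝ] Ell2 := f.isometryOfOrthonormal
    (v := b.toBasis) (by simpa using b.orthonormal) (by
      have : f ∘ b.toBasis = fun k : Fin n => hb k := by
        funext i; simp only [f, Function.comp, Module.Basis.constr_basis]
      rw [this]; exact ho)
  refine ⟨J.toContinuousLinearMap, ContinuousLinearMap.adjoint J.toContinuousLinearMap,
    J.norm_toContinuousLinearMap_le, ?_, ?_⟩
  · rw [LinearIsometryEquiv.norm_map]
    exact J.norm_toContinuousLinearMap_le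
  · ext1 x
    refine ext_inner_right ℝ fun y => ?_
    simp [ContinuousLinearMap.adjoint_inner_left]

lemma approx_embed_le {n : ℕ} (J : EuclideanSpace ℝ (Fin n) →L[ℝ] Ell2)
    (P : Ell2 →L[ℝ] EuclideanSpace ℝ (Fin n)) (hJ : ‖J‖ ≤ 1) (hP : ‖P‖ ≤ 1)
    (hPJ : P.comp J = ContinuousLinearMap.id ℝ _) (k : ℕ) (hk : 1 ≤ k)
    (T : EuclideanSpace ℝ (Fin n) →L[ℝ] EuclideanSpace ℝ (Fin n)) :
    approxNumber k T ≤ approxNumber k (J.comp (T.comp P)) := by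
  refine le_csInf (approx_set_nonempty k hk _) ?_
  rintro r ⟨L, hL, rfl⟩
  have hT : T - P.comp (L.comp J) = P.comp ((J.comp (T.comp P) - L).comp J) := by
    have h : ∀ x, P (J x) = x := fun x => DFunLike.congr_fun hPJ x
    ext1 x
    simp [h]
  refine (approx_le k T (P.comp (L.comp J)) ?_).trans ?_
  · refine lt_of_le_of_lt ?_ hL
    exact (LinearMap.rank_comp_le_right _ _).trans (LinearMap.rank_comp_le_left _ _)
  · rw [hT]
    calc _ ≤ ‖P‖ * (‖J.comp (T.comp P) - L‖ * ‖J‖) := (ContinuousLinearMap.opNorm_comp_le _ _).trans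
          (by gcongr; exact ContinuousLinearMap.opNorm_comp_le _ _)
      _ ≤ 1 * (‖J.comp (T.comp P) - L‖ * 1) := by gcongr
      _ = _ := by ring

/-- The matrix `(b_i (S x_j))`. -/
noncomputable def pairMat {ι : Type*} (S : X →L[ℝ] Y) (x : ι → X) (b : ι → StrongDual ℝ Y) :
    Matrix ι ι ℝ := Matrix.of fun i j => b i (S (x j))

lemma abs_det_pair_le (S : X →L[ℝ] Y) (n : ℕ) (x : Fin n → X) (b : Fin n → StrongDual ℝ Y)
    (hx : ∀ i, ‖x i‖ ≤ 1) (hb : ∀ i, ‖b i‖ ≤ 1) :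
    |(pairMat S x b).det| ≤ ∏ k : Fin n, (n * hilbertNumber (k + 1) S) := by
  let E := EuclideanSpace ℝ (Fin n)
  let A' : E →L[ℝ] X := ∑ j, (EuclideanSpace.proj j : E →L[ℝ] ℝ).smulRight (x j)
  let B' : Y →L[ℝ] E := (EuclideanSpace.equiv (Fin n) ℝ).symm.toContinuousLinearMap.comp
    (ContinuousLinearMap.pi b)
  have hA'x : ∀ f : E, A' f = ∑ j, f j • x j := by
    intro f; simp [A']; rfl
  have hB'x : ∀ y i, B' y i = b i y := by
    intro y i; simp [B']
  have hA : ‖A'‖ ≤ √n := by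
    refine ContinuousLinearMap.opNorm_le_bound _ (by positivity) fun f => ?_
    rw [hA'x]
    calc ‖∑ j, f j • x j‖ ≤ ∑ j, ‖f j‖ * 1 := by
          refine norm_sum_le_of_le _ fun j _ => ?_
          rw [norm_smul]; gcongr; exact hx j
      _ = ∑ j, 1 * ‖f j‖ := by simp
      _ ≤ √(∑ j : Fin n, (1:ℝ) ^ 2) * √(∑ j, ‖f j‖ ^ 2) :=
        Real.sum_mul_le_sqrt_mul_sqrt _ _ _
      _ = √n * ‖f‖ := by rw [EuclideanSpace.norm_eq]; simp
  have hB : ‖B'‖ ≤ √n := by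
    refine ContinuousLinearMap.opNorm_le_bound _ (by positivity) fun y => ?_
    rw [EuclideanSpace.norm_eq, ← Real.sqrt_sq (norm_nonneg y), ← Real.sqrt_mul (by positivity)]
    refine Real.sqrt_le_sqrt ?_
    calc ∑ i, ‖B' y i‖ ^ 2 ≤ ∑ i : Fin n, ‖y‖ ^ 2 := by
          refine Finset.sum_le_sum fun i _ => ?_
          rw [hB'x]
          gcongr
          calc ‖b i y‖ ≤ ‖b i‖ * ‖y‖ := (b i).le_opNorm y
            _ ≤ 1 * ‖y‖ := by gcongr; exact hb i
            _ = ‖y‖ := one_mul _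
      _ = n * ‖y‖ ^ 2 := by simp
  let T : E →L[ℝ] E := B'.comp (S.comp A')
  have hdet : LinearMap.det (T : E →ₗ[ℝ] E) = (pairMat S x b).det := by
    rw [← LinearMap.det_toMatrix (EuclideanSpace.basisFun (Fin n) ℝ).toBasis]
    congr 1
    ext i j
    rw [LinearMap.toMatrix_apply]
    simp [T, hA'x, hB'x, pairMat, Pi.single_apply]
  rw [← hdet]
  refine (abs_det_le_prod T).trans
    (Finset.prod_le_prod (fun _ _ => approx_nonneg _ _) fun k _ => ?_)
  obtain ⟨J, P, hJ, hP, hPJ⟩ := exists_embed n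
  refine (approx_embed_le J P hJ hP hPJ (k + 1) (by omega) T).trans ?_
  have h1 := approx_le_hilbert (k + 1) (by omega) S (A'.comp P) (J.comp B')
  have h2 : (J.comp B').comp (S.comp (A'.comp P)) = J.comp (T.comp P) := rfl
  rw [h2] at h1
  refine h1.trans ?_
  rw [mul_comm]
  refine mul_le_mul_of_nonneg_right ?_ (hilbert_nonneg _ _)
  have hA2 : ‖A'.comp P‖ ≤ √n := by
    calc _ ≤ ‖A'‖ * ‖P‖ := ContinuousLinearMap.opNorm_comp_le _ _
      _ ≤ √n * 1 := by gcongr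
      _ = _ := mul_one _
  have hB2 : ‖J.comp B'‖ ≤ √n := by
    calc _ ≤ ‖J‖ * ‖B'‖ := ContinuousLinearMap.opNorm_comp_le _ _
      _ ≤ 1 * √n := by gcongr
      _ = _ := one_mul _
  calc _ ≤ √n * √n := by gcongr
    _ = n := Real.mul_self_sqrt (by positivity)

/-- Set of volumes. -/
def volSet (S : X →L[ℝ] Y) (n : ℕ) : Set ℝ :=
  {r | ∃ (x : Fin n → X) (b : Fin n → StrongDual ℝ Y), (∀ i, ‖x i‖ ≤ 1) ∧ (∀ i, ‖b i‖ ≤ 1) ∧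
    r = |(pairMat S x b).det|}

lemma volSet_bdd (S : X →L[ℝ] Y) (n : ℕ) : BddAbove (volSet S n) :=
  ⟨_, by rintro r ⟨x, b, hx, hb, rfl⟩; exact abs_det_pair_le S n x b hx hb⟩

lemma volSet_nonempty (S : X →L[ℝ] Y) (n : ℕ) : (volSet S n).Nonempty :=
  ⟨_, 0, 0, by simp, by simp, rfl⟩

lemma abs_det_le_vol {ι : Type*} [Fintype ι] [DecidableEq ι] (S : X →L[ℝ] Y) (n : ℕ)
    (e : ι ≃ Fin n) (x : ι → X) (b : ι → StrongDual ℝ Y)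
    (hx : ∀ i, ‖x i‖ ≤ 1) (hb : ∀ i, ‖b i‖ ≤ 1) :
    |(pairMat S x b).det| ≤ sSup (volSet S n) := by
  refine le_csSup (volSet_bdd S n) ⟨x ∘ e.symm, b ∘ e.symm, fun i => hx _, fun i => hb _, ?_⟩
  have : pairMat S (x ∘ e.symm) (b ∘ e.symm) = Matrix.reindex e e (pairMat S x b) := by
    ext i j; rfl
  rw [this, Matrix.det_reindex_self]

lemma vol_nonneg (S : X →L[ℝ] Y) (n : ℕ) : 0 ≤ sSup (volSet S n) :=
  Real.sSup_nonneg (by rintro r ⟨x, b, -, -, rfl⟩; exact abs_nonneg _)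

lemma approx_mul_det_le (S : X →L[ℝ] Y) (m : ℕ) (x : Fin m → X) (b : Fin m → StrongDual ℝ Y)
    (hx : ∀ i, ‖x i‖ ≤ 1) (hb : ∀ i, ‖b i‖ ≤ 1) :
    approxNumber (m + 1) S * |(pairMat S x b).det| ≤ sSup (volSet S (m + 1)) := by
  by_cases hd : (pairMat S x b).det = 0
  · rw [hd]; simpa using vol_nonneg S (m + 1)
  have hd' : 0 < |(pairMat S x b).det| := abs_pos.mpr hd
  set M := pairMat S x b with hM
  letI : Invertible M := Matrix.invertibleOfIsUnitDet M (isUnit_iff_ne_zero.mpr hd)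
  let L : X →L[ℝ] Y := ∑ j, (∑ i, (⅟M) j i • (b i).comp S).smulRight (S (x j))
  have hLz : ∀ z, L z = ∑ j, (∑ i, (⅟M) j i * b i (S z)) • S (x j) := by
    intro z; simp [L]
  rw [← le_div_iff₀ hd']
  refine (approx_le (m + 1) S L ?_).trans ?_
  · have hr : (L : X →ₗ[ℝ] Y).range ≤ Submodule.span ℝ (Set.range fun j => S (x j)) := by
      rintro _ ⟨z, rfl⟩
      rw [ContinuousLinearMap.coe_coe, hLz]
      exact Submodule.sum_mem _ fun j _ => Submodule.smul_mem _ _ (Submodule.subset_span ⟨j, rfl⟩)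
    have hf : Module.finrank ℝ (L : X →ₗ[ℝ] Y).range ≤ m := by
      have h1 := finrank_range_le_card (R := ℝ) (fun j => S (x j))
      have : FiniteDimensional ℝ (Submodule.span ℝ (Set.range fun j => S (x j))) :=
        FiniteDimensional.span_of_finite ℝ (Set.finite_range _)
      have h2 := Submodule.finrank_mono hr
      rw [Set.finrank, Fintype.card_fin] at h1
      exact h2.trans h1
    have : FiniteDimensional ℝ (Submodule.span ℝ (Set.range fun j => S (x j))) :=
        FiniteDimensional.span_of_finite ℝ (Set.finite_range _)
    have : FiniteDimensional ℝ (L : X →ₗ[ℝ] Y).range := Submodule.finiteDimensional_of_le hr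
    rw [LinearMap.rank, ← Module.finrank_eq_rank]
    exact_mod_cast Nat.lt_succ_of_le hf
  · refine ContinuousLinearMap.opNorm_le_of_unit_norm
      (div_nonneg (vol_nonneg _ _) hd'.le) fun z hz => ?_
    obtain ⟨g, hg1, hg2⟩ := exists_dual_vector'' ℝ ((S - L) z)
    rw [le_div_iff₀ hd']
    have h1 := abs_det_le_vol S (m + 1) (finSumFinEquiv (m := m) (n := 1))
      (Sum.elim x fun _ => z) (Sum.elim b fun _ => g)
      (by rintro (i | i); exacts [hx i, hz.le]) (by rintro (i | i); exacts [hb i, hg1])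
    have h2 : pairMat S (Sum.elim x fun _ : Fin 1 => z) (Sum.elim b fun _ : Fin 1 => g) =
        Matrix.fromBlocks M (Matrix.of fun i _ => b i (S z)) (Matrix.of fun _ j => g (S (x j)))
          (Matrix.of fun _ _ => g (S z)) := by
      ext (i | i) (j | j) <;> rfl
    rw [h2, Matrix.det_fromBlocks₁₁, abs_mul, mul_comm] at h1
    refine le_trans (le_of_eq ?_) h1
    congr 1
    have h3 : g ((S - L) z) = g (S z) - ∑ j, (∑ i, (⅟M) j i * b i (S z)) * g (S (x j)) := by
      simp [hLz]
    have h4 : ‖(S - L) z‖ = |g ((S - L) z)| := by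
      rw [hg2]; simp
    rw [h4, h3, Matrix.det_fin_one]
    congr 1
    rw [Matrix.sub_apply, Matrix.mul_assoc, Matrix.mul_apply]
    congr 1
    refine Finset.sum_congr rfl fun j _ => ?_
    rw [Matrix.mul_apply, mul_comm]
    rfl

lemma approx_mul_vol_le (S : X →L[ℝ] Y) (m : ℕ) :
    approxNumber (m + 1) S * sSup (volSet S m) ≤ sSup (volSet S (m + 1)) := by
  rcases (approx_nonneg (m + 1) S).eq_or_lt with h | h
  · rw [← h, zero_mul]; exact vol_nonneg _ _
  rw [mul_comm, ← le_div_iff₀ h]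
  refine csSup_le (volSet_nonempty S m) ?_
  rintro r ⟨x, b, hx, hb, rfl⟩
  rw [le_div_iff₀ h, mul_comm]
  exact approx_mul_det_le S m x b hx hb

lemma approx_pow_le_vol (S : X →L[ℝ] Y) (n k : ℕ) (hk : k ≤ n) :
    approxNumber n S ^ k ≤ sSup (volSet S k) := by
  induction k with
  | zero =>
    refine le_csSup (volSet_bdd S 0) ⟨0, 0, by simp, by simp, by simp⟩
  | succ k ih =>
    refine le_trans ?_ (approx_mul_vol_le S k)
    rw [pow_succ, mul_comm]
    exact mul_le_mul (approx_anti (by omega) hk S) (ih (by omega))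
      (pow_nonneg (approx_nonneg _ _) _) (approx_nonneg _ _)

lemma approx_pow_le (S : X →L[ℝ] Y) (n : ℕ) :
    approxNumber n S ^ n ≤ ∏ k : Fin n, (n * hilbertNumber (k + 1) S) := by
  refine (approx_pow_le_vol S n n le_rfl).trans (csSup_le (volSet_nonempty S n) ?_)
  rintro r ⟨x, b, hx, hb, rfl⟩
  exact abs_det_pair_le S n x b hx hb

end Det

theorem approx_le_exp_mul_sup_hilbert
    {X Y : Type*} [NormedAddCommGroup X] [NormedSpace ℝ X] [CompleteSpace X]
    [NormedAddCommGroup Y] [NormedSpace ℝ Y] [CompleteSpace Y]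
    (S : X →L[ℝ] Y) (α : ℝ) (hα : 0 < α) (n : ℕ) (hn : 1 ≤ n) :
    approxNumber n S ≤
      2 * Real.exp 1 ^ α * (n : ℝ) ^ (-α + 3 / 2) *
        (Finset.Icc 1 n).sup' (Finset.nonempty_Icc.mpr hn)
          (fun k => (k : ℝ) ^ α * hilbertNumber k S) := by
  set C := (Finset.Icc 1 n).sup' (Finset.nonempty_Icc.mpr hn)
          (fun k => (k : ℝ) ^ α * hilbertNumber k S) with hC
  have hn0 : (0 : ℝ) < n := by exact_mod_cast hn
  have hCk : ∀ k, 1 ≤ k → k ≤ n → (k : ℝ) ^ α * hilbertNumber k S ≤ C := fun k h1 h2 =>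
    Finset.le_sup' (fun k : ℕ => (k : ℝ) ^ α * hilbertNumber k S) (Finset.mem_Icc.mpr ⟨h1, h2⟩)
  have hC0 : 0 ≤ C :=
    le_trans (mul_nonneg (by positivity) (hilbert_nonneg _ _)) (hCk n hn le_rfl)
  have hfac : ((n : ℝ) / Real.exp 1) ^ n ≤ n.factorial := by
    have h := Real.pow_div_factorial_le_exp (x := n) hn0.le n
    rw [div_le_iff₀ (by positivity)] at h
    rw [div_pow, div_le_iff₀ (by positivity), ← Real.exp_nat_mul, mul_one, mul_comm]
    exact h
  have hmain : approxNumber n S ≤ n * C * ((n : ℝ) / Real.exp 1) ^ (-α) := by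
    refine le_of_pow_le_pow_left₀ (n := n) (by omega) (by positivity) ?_
    refine (approx_pow_le S n).trans ?_
    calc ∏ k : Fin n, (n * hilbertNumber (k + 1) S)
        ≤ ∏ k : Fin n, (n * C * ((k + 1 : ℕ) : ℝ) ^ (-α)) := by
          refine Finset.prod_le_prod
            (fun k _ => mul_nonneg hn0.le (hilbert_nonneg _ _)) fun k _ => ?_
          rw [mul_assoc]
          refine mul_le_mul_of_nonneg_left ?_ hn0.le
          have := hCk (k + 1) (by omega) (by omega)
          rw [Real.rpow_neg (by positivity), ← div_eq_mul_inv, le_div_iff₀ (by positivity),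
            mul_comm]
          exact this
      _ = (n * C) ^ n * (n.factorial : ℝ) ^ (-α) := by
          rw [Finset.prod_mul_distrib, Real.finsetProd_rpow _ _ (fun _ _ => by positivity)]
          congr 2
          · simp
          · rw [← Finset.prod_range_add_one_eq_factorial, Nat.cast_prod,
              Finset.prod_range (fun i => ((i + 1 : ℕ) : ℝ))]
      _ ≤ (n * C) ^ n * (((n : ℝ) / Real.exp 1) ^ n) ^ (-α) := by
          refine mul_le_mul_of_nonneg_left ?_ (by positivity)
          exact Real.rpow_le_rpow_of_nonpos (by positivity) hfac (by linarith)
      _ = _ := by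
          rw [mul_pow (n * C : ℝ), ← Real.rpow_natCast (((n : ℝ) / Real.exp 1) ^ (-α)),
            ← Real.rpow_mul (by positivity), ← Real.rpow_natCast ((n : ℝ) / Real.exp 1),
            ← Real.rpow_mul (by positivity), mul_comm (-α)]
  refine hmain.trans ?_
  have h1 : ((n : ℝ) / Real.exp 1) ^ (-α) = Real.exp 1 ^ α * (n : ℝ) ^ (-α) := by
    rw [Real.div_rpow hn0.le (by positivity), Real.rpow_neg (Real.exp_pos 1).le, div_inv_eq_mul,
      mul_comm]
  rw [h1, Real.rpow_add hn0]
  have h2 : (n : ℝ) ≤ 2 * (n : ℝ) ^ (3 / 2 : ℝ) := by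
    have : (n : ℝ) ^ (1 : ℝ) ≤ (n : ℝ) ^ (3 / 2 : ℝ) :=
      Real.rpow_le_rpow_of_exponent_le (by exact_mod_cast hn) (by norm_num)
    rw [Real.rpow_one] at this
    linarith
  calc (n : ℝ) * C * (Real.exp 1 ^ α * (n : ℝ) ^ (-α))
      = n * (C * (Real.exp 1 ^ α * (n : ℝ) ^ (-α))) := by ring
    _ ≤ 2 * (n : ℝ) ^ (3 / 2 : ℝ) * (C * (Real.exp 1 ^ α * (n : ℝ) ^ (-α))) := by gcongr
    _ = _ := by ring
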